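/- For any k = o(log d), any real d-variate polynomial p satisfying |p(x) − OR_d(x)| ≤ 1/6 for all x ∈ {-1,1}^d of Hamming weight at most k, whose coefficient vector has L₁-norm d^{O(1)}, must have degree at least d^{1−O(1/√k)}. -/

import Mathlib

open Classical in
/-- Degree of a multilinear polynomial given by its coefficient vector. -/
noncomputable def polyDegree {ι : Type*} [Fintype ι] (c : Finset ι → ℝ) : ℕ :=
  Finset.sup (Finset.univ.filter fun S => c S ≠ 0) Finset.card

/-- Evaluation of a multilinear polynomial given by its coefficient vector. -/
noncomputable def evalPoly {ι : Type*} [Fintype ι] (c : Finset ι → ℝ) (x : ι → ℝ) : ℝ :=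
  ∑ S : Finset ι, c S * ∏ i ∈ S, x i

/-- Weight (L1-norm of the coefficient vector) of a multilinear polynomial. -/
noncomputable def weight {ι : Type*} [Fintype ι] (c : Finset ι → ℝ) : ℝ :=
  ∑ S : Finset ι, |c S|

open Classical in
/-- The OR function on `{-1,1}^d`, with `-1` = TRUE. -/
noncomputable def ORd {d : ℕ} (x : Fin d → ℝ) : ℝ :=
  if ∃ i, x i = -1 then -1 else 1

/-- The Boolean cube `{-1,1}^d` inside `ℝ^d`. -/
def cube (d : ℕ) : Set (Fin d → ℝ) := {x | ∀ i, x i = 1 ∨ x i = -1}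

open Classical in
/-- Hamming weight: number of coordinates equal to `-1`. -/
noncomputable def hamming {d : ℕ} (x : Fin d → ℝ) : ℕ :=
  (Finset.univ.filter fun i => x i = -1).card


/-- first part -/
lemma prodA (i n : ℕ) (h : n < i) :
    ∏ j ∈ Finset.Icc 1 n, ((j:ℝ)^2 / |(i:ℝ)^2 - (j:ℝ)^2|)
      = (n.factorial:ℝ)^2 * ((i-1-n).factorial : ℝ) * i / ((i+n).factorial : ℝ) := by
  induction n with
  | zero =>
    obtain ⟨i, rfl⟩ : ∃ t, i = t + 1 := ⟨i-1, by omega⟩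
    have : ((i.factorial : ℕ):ℝ) ≠ 0 := by positivity
    simp [Nat.factorial_succ]
    field_simp
  | succ n ih =>
    rw [Finset.prod_Icc_succ_top (by omega), ih (by omega)]
    obtain ⟨r, rfl⟩ : ∃ r, i = n + r + 2 := ⟨i - n - 2, by omega⟩
    have e1 : n + r + 2 - 1 - n = r + 1 := by omega
    have e2 : n + r + 2 - 1 - (n+1) = r := by omega
    have e3 : n + r + 2 + (n+1) = (n + r + 2 + n) + 1 := by omega
    rw [e1, e2, e3, Nat.factorial_succ n, Nat.factorial_succ r, Nat.factorial_succ (n+r+2+n)]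
    have : |((n+r+2:ℕ):ℝ)^2 - ((n+1:ℕ):ℝ)^2| = ((r:ℝ)+1) * (n+r+2+n+1) := by
      rw [abs_of_nonneg]
      · push_cast; ring
      · have : ((n+1:ℕ):ℝ) ≤ ((n+r+2:ℕ):ℝ) := by exact_mod_cast (by omega)
        have h0 : (0:ℝ) ≤ ((n+1:ℕ):ℝ) := by positivity
        nlinarith
    rw [this]
    push_cast
    field_simp

lemma prodB (i m : ℕ) (hi : 1 ≤ i) (h : i ≤ m) :
    ∏ j ∈ (Finset.Icc 1 m).erase i, ((j:ℝ)^2 / |(i:ℝ)^2 - (j:ℝ)^2|)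
      = 2 * (m.factorial:ℝ)^2 / (((m-i).factorial : ℝ) * ((m+i).factorial : ℝ)) := by
  induction m, h using Nat.le_induction with
  | base =>
    have : (Finset.Icc 1 i).erase i = Finset.Icc 1 (i-1) := by ext x; simp; omega
    rw [this, prodA i (i-1) (by omega)]
    obtain ⟨r, rfl⟩ : ∃ t, i = t + 1 := ⟨i-1, by omega⟩
    have e1 : r + 1 + (r+1) = (r+1+r)+1 := by omega
    simp only [Nat.add_sub_cancel, Nat.sub_self]
    rw [e1, Nat.factorial_succ r, Nat.factorial_succ (r+1+r)]
    push_cast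
    simp
    field_simp
    ring
  | succ m hm ih =>
    have : (Finset.Icc 1 (m+1)).erase i = insert (m+1) ((Finset.Icc 1 m).erase i) := by
      ext x; simp; omega
    rw [this, Finset.prod_insert (by simp), ih]
    obtain ⟨r, rfl⟩ : ∃ r, m = i + r := ⟨m - i, by omega⟩
    have e1 : i + r - i = r := by omega
    have e2 : i + r + 1 - i = r + 1 := by omega
    have e3 : i + r + 1 + i = (i + r + i) + 1 := by omega
    rw [e1, e2, e3, Nat.factorial_succ (i+r), Nat.factorial_succ r, Nat.factorial_succ (i+r+i)]
    have : |(i:ℝ)^2 - ((i+r+1:ℕ):ℝ)^2| = ((r:ℝ)+1) * (i+r+i+1) := by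
      rw [abs_sub_comm, abs_of_nonneg]
      · push_cast; ring
      · have : ((i:ℕ):ℝ) ≤ ((i+r+1:ℕ):ℝ) := by exact_mod_cast (by omega)
        have h0 : (0:ℝ) ≤ (i:ℝ) := by positivity
        nlinarith
    rw [this]
    push_cast
    field_simp

lemma prodC (i m : ℕ) (hi : 1 ≤ i) (h : i ≤ m) :
    ∏ j ∈ (Finset.Icc 1 m).erase i, ((j:ℝ)^2 / |(i:ℝ)^2 - (j:ℝ)^2|) ≤ 2 := by
  rw [prodB i m hi h, div_le_iff₀ (by positivity)]
  have h1 := Nat.choose_le_centralBinom (m - i) m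
  have h2 := Nat.choose_mul_factorial_mul_factorial (n := 2*m) (k := m-i) (by omega)
  have h3 := Nat.choose_mul_factorial_mul_factorial (n := 2*m) (k := m) (by omega)
  rw [show 2*m - (m-i) = m + i by omega] at h2
  rw [show 2*m - m = m by omega] at h3
  rw [Nat.centralBinom] at h1
  have h5 : 0 < (2*m).choose m := Nat.choose_pos (by omega)
  have h4 : m.factorial^2 ≤ (m-i).factorial * (m+i).factorial := by
    refine Nat.le_of_mul_le_mul_left ?_ h5
    calc (2*m).choose m * m.factorial^2 = (2*m).factorial := by rw [← h3]; ring
      _ = (2*m).choose (m-i) * ((m-i).factorial * (m+i).factorial) := by rw [← h2]; ring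
      _ ≤ _ := Nat.mul_le_mul_right _ h1
  have : (m.factorial:ℝ)^2 ≤ (m-i).factorial * (m+i).factorial := by exact_mod_cast h4
  linarith

/-- interpolation nodes -/
def nodeV (r : ℕ) : ℕ := if r = 0 then 1 else 2 * r^2

lemma nodeV_inj : Function.Injective nodeV := by
  intro a b h
  unfold nodeV at h
  split_ifs at h with h1 h2 h2
  · omega
  · omega
  · omega
  · have : a^2 = b^2 := by omega
    exact Nat.pow_left_injective (by norm_num) this

lemma nodeV_pos (r : ℕ) : 1 ≤ nodeV r := by
  unfold nodeV
  split_ifs with h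
  · omega
  · have : 0 < r^2 := by positivity
    omega

lemma nodeV_le (r m k : ℕ) (hr : r ≤ m) (hk : 1 ≤ k) (h : 2 * m^2 ≤ k) : nodeV r ≤ k := by
  unfold nodeV
  split_ifs with h
  · omega
  · have : r^2 ≤ m^2 := Nat.pow_le_pow_left hr 2
    omega

lemma sum_inv_sq_aux (n : ℕ) :
    ∑ i ∈ Finset.Icc 1 (n+1), ((1:ℝ) / (i:ℝ)^2) ≤ 2 - (1:ℝ) / ((n:ℝ)+1) := by
  induction n with
  | zero => norm_num
  | succ n ih =>
    rw [Finset.sum_Icc_succ_top (by omega)]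
    have h : (1:ℝ) / (((n:ℝ)+1+1)^2) ≤ 1 / ((n:ℝ)+1) - 1/((n:ℝ)+1+1) := by
      rw [div_sub_div _ _ (by positivity) (by positivity), div_le_div_iff₀ (by positivity) (by positivity)]
      nlinarith [Nat.cast_nonneg (α := ℝ) n]
    push_cast at ih ⊢
    linarith

lemma sum_inv_sq (m : ℕ) : ∑ i ∈ Finset.Icc 1 m, ((1:ℝ) / (i:ℝ)^2) ≤ 2 := by
  rcases m with _ | n
  · norm_num
  · have h := sum_inv_sq_aux n
    have : (0:ℝ) ≤ 1 / ((n:ℝ)+1) := by positivity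
    linarith

lemma weights (m : ℕ) : ∃ α : ℕ → ℝ,
    (∀ i ≤ m, ∑ r ∈ Finset.range (m+1), α r * ((nodeV r).choose i : ℝ) = if i = 0 then 1 else 0) ∧
    ∑ r ∈ Finset.range (m+1), |α r| ≤ 9 := by
  set s := Finset.range (m+1) with hs
  set v : ℕ → ℝ := fun r => (nodeV r : ℝ) with hv
  have hinj : Set.InjOn v s := fun a _ b _ h => nodeV_inj (by simpa [hv] using h)
  set α : ℕ → ℝ := fun r => (Lagrange.basis s v r).eval 0 with hα
  have hmom : ∀ i ≤ m, ∑ r ∈ s, α r * ((nodeV r).choose i : ℝ) = if i = 0 then 1 else 0 := by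
    intro i hi
    have hdeg : (descPochhammer ℝ i).degree < (s.card : ℕ) := by
      refine Polynomial.degree_le_natDegree.trans_lt ?_
      rw [descPochhammer_natDegree, hs, Finset.card_range]
      exact_mod_cast (by omega : i < m + 1)
    have h := congrArg (Polynomial.eval 0) (Lagrange.eq_interpolate hinj hdeg)
    rw [Lagrange.interpolate_apply, Polynomial.eval_finsetSum] at h
    simp only [Polynomial.eval_mul, Polynomial.eval_C, hv, descPochhammer_eval_eq_descFactorial] at h
    have h0 : Polynomial.eval (0:ℝ) (descPochhammer ℝ i) = ((0:ℕ).descFactorial i : ℝ) := by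
      rw [← descPochhammer_eval_eq_descFactorial]; simp
    rw [h0] at h
    simp only [Nat.descFactorial_eq_factorial_mul_choose] at h
    have hf : (i.factorial : ℝ) ≠ 0 := by positivity
    apply mul_left_cancel₀ hf
    rw [Finset.mul_sum]
    push_cast at h
    calc _ = ∑ x ∈ s, (i.factorial:ℝ) * ((nodeV x).choose i : ℝ) * (Lagrange.basis s v x).eval 0 := by
            refine Finset.sum_congr rfl fun x _ => ?_
            simp only [hα]; ring
      _ = _ := by
        rw [← h]
        rcases i with _ | i <;> simp
  refine ⟨α, hmom, ?_⟩
  have heval : ∀ r, α r = ∏ j ∈ s.erase r, ((v r - v j)⁻¹ * (0 - v j)) := by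
    intro r
    simp only [hα, Lagrange.basis, Polynomial.eval_prod, Lagrange.basisDivisor, Polynomial.eval_mul,
      Polynomial.eval_C, Polynomial.eval_sub, Polynomial.eval_X]
  have h0 : 0 ≤ α 0 := by
    rw [heval]
    refine Finset.prod_nonneg fun j hj => ?_
    have h1 : (1:ℝ) ≤ v j := by simp only [hv]; exact_mod_cast nodeV_pos j
    have : v 0 = 1 := by simp [hv, nodeV]
    rw [this]
    exact mul_nonneg_of_nonpos_of_nonpos (inv_nonpos.2 (by linarith)) (by linarith)
  have hb : ∀ r ∈ Finset.Icc 1 m, |α r| ≤ 2 * (1 / (r:ℝ)^2) := by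
    intro r hr
    rw [Finset.mem_Icc] at hr
    have hse : s.erase r = insert 0 ((Finset.Icc 1 m).erase r) := by
      ext x; simp [hs]; omega
    rw [heval, hse, Finset.prod_insert (by simp), abs_mul, Finset.abs_prod]
    have hp : ∏ j ∈ (Finset.Icc 1 m).erase r, |(v r - v j)⁻¹ * (0 - v j)|
        = ∏ j ∈ (Finset.Icc 1 m).erase r, ((j:ℝ)^2 / |(r:ℝ)^2 - (j:ℝ)^2|) := by
      refine Finset.prod_congr rfl fun j hj => ?_
      simp only [Finset.mem_erase, Finset.mem_Icc] at hj
      have e1 : v r = 2 * (r:ℝ)^2 := by simp [hv, nodeV, show r ≠ 0 by omega]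
      have e2 : v j = 2 * (j:ℝ)^2 := by simp [hv, nodeV, show j ≠ 0 by omega]
      rw [e1, e2, ← mul_sub, abs_mul, abs_inv, abs_mul, zero_sub, abs_neg, abs_mul, abs_two,
        abs_of_nonneg (sq_nonneg (j:ℝ)), mul_inv]
      field_simp
    rw [hp]
    have e1 : v r = 2 * (r:ℝ)^2 := by simp [hv, nodeV, show r ≠ 0 by omega]
    have e2 : v 0 = 1 := by simp [hv, nodeV]
    have hr1 : (1:ℝ) ≤ r := by exact_mod_cast hr.1
    have h1 : |(v r - v 0)⁻¹ * (0 - v 0)| ≤ 1 / (r:ℝ)^2 := by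
      rw [e1, e2, abs_mul, abs_inv, abs_of_nonneg (by nlinarith)]
      norm_num
      apply inv_anti₀ (by positivity)
      nlinarith
    calc _ ≤ 1 / (r:ℝ)^2 * 2 := mul_le_mul h1 (prodC r m hr.1 hr.2)
            (Finset.prod_nonneg fun j _ => by positivity) (by positivity)
      _ = _ := by ring
  have hsplit : ∀ f : ℕ → ℝ, ∑ r ∈ s, f r = f 0 + ∑ r ∈ Finset.Icc 1 m, f r := by
    intro f
    have : s = insert 0 (Finset.Icc 1 m) := by ext x; simp [hs]; omega
    rw [this, Finset.sum_insert (by simp)]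
  have hB : ∑ r ∈ Finset.Icc 1 m, |α r| ≤ 4 := by
    refine (Finset.sum_le_sum hb).trans ?_
    rw [← Finset.mul_sum]
    have := sum_inv_sq m
    linarith
  have h1 := hmom 0 (by omega)
  simp only [Nat.choose_zero_right, Nat.cast_one, mul_one, if_true] at h1
  rw [hsplit] at h1 ⊢
  have h2 : |∑ r ∈ Finset.Icc 1 m, α r| ≤ 4 := (Finset.abs_sum_le_sum_abs _ _).trans hB
  rw [abs_of_nonneg h0]
  have := neg_le_of_abs_le h2
  linarith

lemma remainder (m k : ℕ) (hk : 1 ≤ k) (hmk : 2 * m^2 ≤ k) (α : ℕ → ℝ)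
    (h1 : ∀ i ≤ m, ∑ r ∈ Finset.range (m+1), α r * ((nodeV r).choose i : ℝ) = if i = 0 then 1 else 0)
    (h2 : ∑ r ∈ Finset.range (m+1), |α r| ≤ 9) (u η : ℝ) (hu : 0 ≤ u) (huη : k * u ≤ η)
    (hη : η ≤ 1/2) :
    |1 - ∑ r ∈ Finset.range (m+1), α r * (1 - u)^(nodeV r)| ≤ 18 * η^(m+1) := by
  have hmk' : m ≤ k := by nlinarith
  have hη0 : 0 ≤ η := le_trans (by positivity) huη
  have hexp : ∀ r ∈ Finset.range (m+1), (1 - u)^(nodeV r)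
      = ∑ i ∈ Finset.range (k+1), ((nodeV r).choose i : ℝ) * (-u)^i := by
    intro r hr
    have hle := nodeV_le r m k (by simpa [Nat.lt_succ_iff] using hr) hk hmk
    rw [sub_eq_neg_add, add_pow]
    simp only [one_pow, mul_one]
    rw [Finset.sum_subset (Finset.range_mono (show nodeV r + 1 ≤ k + 1 by omega))]
    · exact Finset.sum_congr rfl fun i _ => mul_comm _ _
    · intro i _ hi
      rw [Nat.choose_eq_zero_of_lt (by simpa using hi)]; simp
  have hsum : ∑ r ∈ Finset.range (m+1), α r * (1 - u)^(nodeV r)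
      = ∑ i ∈ Finset.range (k+1), (-u)^i * ∑ r ∈ Finset.range (m+1), α r * ((nodeV r).choose i : ℝ) := by
    rw [Finset.sum_congr rfl fun r hr => by rw [hexp r hr]]
    simp only [Finset.mul_sum]
    rw [Finset.sum_comm]
    exact Finset.sum_congr rfl fun i _ => Finset.sum_congr rfl fun r _ => by ring
  have hlow : ∑ i ∈ Finset.range (m+1), (-u)^i * ∑ r ∈ Finset.range (m+1), α r * ((nodeV r).choose i : ℝ) = 1 := by
    rw [Finset.sum_congr rfl fun i hi => by rw [h1 i (by simpa [Nat.lt_succ_iff] using hi)]]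
    simp
  rw [hsum, ← Finset.sum_range_add_sum_Ico _ (show m+1 ≤ k+1 by omega), hlow, sub_add_cancel_left, abs_neg]
  have hterm : ∀ i ∈ Finset.Ico (m+1) (k+1),
      |(-u)^i * ∑ r ∈ Finset.range (m+1), α r * ((nodeV r).choose i : ℝ)| ≤ 9 * η^i := by
    intro i _
    rw [abs_mul, abs_pow, abs_neg, abs_of_nonneg hu]
    have : |∑ r ∈ Finset.range (m+1), α r * ((nodeV r).choose i : ℝ)| ≤ 9 * (k:ℝ)^i := by
      refine (Finset.abs_sum_le_sum_abs _ _).trans ?_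
      refine le_trans ?_ (mul_le_mul_of_nonneg_right h2 (by positivity))
      rw [Finset.sum_mul]
      refine Finset.sum_le_sum fun r hr => ?_
      rw [abs_mul]
      refine mul_le_mul_of_nonneg_left ?_ (abs_nonneg _)
      rw [abs_of_nonneg (by positivity)]
      have hle := nodeV_le r m k (by simpa [Nat.lt_succ_iff] using hr) hk hmk
      exact_mod_cast (Nat.choose_le_pow (nodeV r) i).trans (Nat.pow_le_pow_left hle i)
    calc _ ≤ u^i * (9 * (k:ℝ)^i) := mul_le_mul_of_nonneg_left this (by positivity)
      _ = 9 * (k*u)^i := by rw [mul_pow]; ring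
      _ ≤ _ := by gcongr
  refine (Finset.abs_sum_le_sum_abs _ _).trans ((Finset.sum_le_sum hterm).trans ?_)
  rw [← Finset.mul_sum, Finset.sum_Ico_eq_sum_range]
  have hg : ∀ n : ℕ, ∑ i ∈ Finset.range n, η^(m+1+i) ≤ 2 * η^(m+1) := by
    intro n
    simp only [pow_add η (m+1), ← Finset.mul_sum]
    have h3 : ∑ i ∈ Finset.range n, η^i ≤ 2 := by
      have := mul_neg_geom_sum η n
      have hp : 0 ≤ η^n := by positivity
      have hs : 0 ≤ ∑ i ∈ Finset.range n, η^i := Finset.sum_nonneg fun i _ => by positivity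
      nlinarith
    rw [mul_comm]
    exact mul_le_mul_of_nonneg_right h3 (by positivity)
  have := hg (k+1-(m+1))
  linarith
/-- the point obtained from the all-ones point by flipping `I 0, I 1, ...` successively -/
noncomputable def flipPt {d t : ℕ} (I : Fin t → Fin d) : Fin d → ℝ :=
  fun j => ∏ l, (if I l = j then (-1:ℝ) else 1)

lemma flipPt_cube {d t : ℕ} (I : Fin t → Fin d) : flipPt I ∈ cube d := by
  intro j
  unfold flipPt
  refine Finset.prod_induction _ (fun y : ℝ => y = 1 ∨ y = -1) ?_ (Or.inl rfl) ?_
  · rintro a b (rfl | rfl) (rfl | rfl) <;> norm_num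
  · intro l _
    split_ifs <;> simp

lemma flipPt_hamming {d t : ℕ} (I : Fin t → Fin d) : hamming (flipPt I) ≤ t := by
  classical
  unfold hamming
  calc _ ≤ (Finset.univ.image I).card := by
        refine Finset.card_le_card fun j hj => ?_
        simp only [Finset.mem_filter, Finset.mem_univ, true_and] at hj
        by_contra hne
        simp only [Finset.mem_image, Finset.mem_univ, true_and, not_exists] at hne
        have : flipPt I j = 1 := by
          unfold flipPt
          exact Finset.prod_eq_one fun l _ => by rw [if_neg (hne l)]
        rw [this] at hj
        norm_num at hj
    _ ≤ _ := Finset.card_image_le.trans (by simp)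

lemma flipPt_mono {d t : ℕ} (S : Finset (Fin d)) (I : Fin t → Fin d) :
    ∏ j ∈ S, flipPt I j = ∏ l, (if I l ∈ S then (-1:ℝ) else 1) := by
  unfold flipPt
  rw [Finset.prod_comm]
  refine Finset.prod_congr rfl fun l _ => ?_
  rw [Finset.prod_ite_eq]

lemma sum_flipPt_mono {d t : ℕ} (S : Finset (Fin d)) :
    ∑ I : Fin t → Fin d, ∏ j ∈ S, flipPt I j = ((d:ℝ) - 2 * S.card)^t := by
  simp only [flipPt_mono]
  rw [← Fintype.sum_pow (fun i : Fin d => if i ∈ S then (-1:ℝ) else 1)]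
  congr 1
  have : ∀ i : Fin d, (if i ∈ S then (-1:ℝ) else 1) = 1 - 2 * (if i ∈ S then (1:ℝ) else 0) := by
    intro i; split_ifs <;> norm_num
  simp only [this, Finset.sum_sub_distrib, ← Finset.mul_sum]
  simp

lemma card_bad {d t : ℕ} :
    (Finset.univ.filter fun I : Fin (t+1) → Fin d => ∀ j, flipPt I j = 1).card ≤ d^t := by
  classical
  have hc : (Finset.univ : Finset (Fin t → Fin d)).card = d^t := by simp
  rw [← hc]
  refine Finset.card_le_card_of_injOn Fin.tail (fun _ _ => Finset.mem_coe.2 (Finset.mem_univ _)) ?_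
  intro I hI J hJ h
  simp only [Finset.coe_filter, Finset.mem_univ, true_and, Set.mem_ofPred_eq] at hI hJ
  have key : ∀ K : Fin (t+1) → Fin d, ∀ j, flipPt K j =
      (if K 0 = j then (-1:ℝ) else 1) * flipPt (Fin.tail K) j := by
    intro K j
    unfold flipPt
    rw [Fin.prod_univ_succ]
    rfl
  have h0 : I 0 = J 0 := by
    by_contra hne
    have h1 := hI (I 0)
    have h2 := hJ (I 0)
    rw [key, if_pos rfl, h] at h1
    rw [key, if_neg (fun e => hne e.symm)] at h2
    linarith
  rw [← Fin.cons_self_tail I, ← Fin.cons_self_tail J, h, h0]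

/-- averaged polynomial -/
noncomputable def avgF {d : ℕ} (c : Finset (Fin d) → ℝ) (t : ℕ) : ℝ :=
  ∑ S : Finset (Fin d), c S * (1 - 2 * S.card / d)^t

lemma avgF_eq {d : ℕ} (hd : 0 < d) (c : Finset (Fin d) → ℝ) (t : ℕ) :
    (d:ℝ)^t * avgF c t = ∑ I : Fin t → Fin d, evalPoly c (flipPt I) := by
  unfold avgF evalPoly
  rw [Finset.sum_comm, Finset.mul_sum]
  refine Finset.sum_congr rfl fun S _ => ?_
  rw [← Finset.mul_sum, sum_flipPt_mono]
  have : (d:ℝ) ≠ 0 := by positivity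
  have h : (d:ℝ) - 2 * S.card = d * (1 - 2 * S.card / d) := by field_simp
  rw [h, mul_pow]; ring

lemma avgF_zero {d k : ℕ} (c : Finset (Fin d) → ℝ)
    (h : ∀ x ∈ cube d, hamming x ≤ k → |evalPoly c x - ORd x| ≤ 1 / 6) :
    5/6 ≤ avgF c 0 := by
  have h1 := h (fun _ => 1) (fun _ => Or.inl rfl) (by simp [hamming]; norm_num)
  have h2 : ORd (fun _ : Fin d => (1:ℝ)) = 1 := by
    unfold ORd; rw [if_neg]; rintro ⟨i, hi⟩; norm_num at hi
  have h3 : evalPoly c (fun _ : Fin d => (1:ℝ)) = avgF c 0 := by simp [evalPoly, avgF]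
  rw [h2, h3] at h1
  have := (abs_le.1 h1).1
  linarith

lemma avgF_pos {d k : ℕ} (hd : 0 < d) (c : Finset (Fin d) → ℝ)
    (h : ∀ x ∈ cube d, hamming x ≤ k → |evalPoly c x - ORd x| ≤ 1 / 6) (t : ℕ) (ht : 1 ≤ t)
    (htk : t ≤ k) : |avgF c t + 1| ≤ 1/6 + 2/d := by
  classical
  obtain ⟨t, rfl⟩ : ∃ s, t = s + 1 := ⟨t-1, by omega⟩
  have hd' : (0:ℝ) < d := by exact_mod_cast hd
  have hpt : ∀ I : Fin (t+1) → Fin d, |evalPoly c (flipPt I) + 1| ≤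
      1/6 + 2 * (if ∀ j, flipPt I j = 1 then (1:ℝ) else 0) := by
    intro I
    have h1 := h _ (flipPt_cube I) ((flipPt_hamming I).trans htk)
    split_ifs with hb
    · have : ORd (flipPt I) = 1 := by
        unfold ORd; rw [if_neg]; rintro ⟨i, hi⟩; rw [hb i] at hi; norm_num at hi
      rw [this] at h1
      rw [abs_le] at h1 ⊢
      constructor <;> linarith [h1.1, h1.2]
    · have : ORd (flipPt I) = -1 := by
        unfold ORd; rw [if_pos]
        push Not at hb
        obtain ⟨j, hj⟩ := hb
        exact ⟨j, ((flipPt_cube I) j).resolve_left hj⟩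
      rw [this] at h1
      simpa using h1
  have hsum : (d:ℝ)^(t+1) * (avgF c (t+1) + 1) = ∑ I : Fin (t+1) → Fin d, (evalPoly c (flipPt I) + 1) := by
    rw [mul_add, avgF_eq hd, Finset.sum_add_distrib]
    simp
  have hp : (0:ℝ) < (d:ℝ)^(t+1) := by positivity
  have hb : (d:ℝ)^(t+1) * |avgF c (t+1) + 1| ≤ (d:ℝ)^(t+1) * (1/6 + 2/d) := by
    rw [← abs_of_pos hp, ← abs_mul, abs_of_pos hp, hsum]
    refine (Finset.abs_sum_le_sum_abs _ _).trans ((Finset.sum_le_sum fun I _ => hpt I).trans ?_)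
    rw [Finset.sum_add_distrib, ← Finset.mul_sum, Finset.sum_boole]
    have hc : ((Finset.univ.filter fun I : Fin (t+1) → Fin d => ∀ j, flipPt I j = 1).card : ℝ) ≤ (d:ℝ)^t := by
      exact_mod_cast card_bad
    have e : (d:ℝ)^(t+1) * (1/6 + 2/d) = (d:ℝ)^(t+1) * (1/6) + 2 * (d:ℝ)^t := by
      field_simp
      ring
    rw [e]
    simp only [Finset.sum_const, Finset.card_univ, Fintype.card_pi, Fintype.card_fin, Finset.prod_const, nsmul_eq_mul]
    push_cast
    linarith
  exact le_of_mul_le_mul_left hb hp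

lemma core {d k m : ℕ} (hd : 108 ≤ d) (hk : 1 ≤ k) (hmk : 2 * m^2 ≤ k) (c : Finset (Fin d) → ℝ)
    (h : ∀ x ∈ cube d, hamming x ≤ k → |evalPoly c x - ORd x| ≤ 1 / 6) (η : ℝ)
    (hη : k * (2 * polyDegree c / d) ≤ η) (hη2 : η ≤ 1/2) :
    1/6 ≤ weight c * (18 * η^(m+1)) := by
  classical
  obtain ⟨α, h1, h2⟩ := weights m
  have hd' : (108:ℝ) ≤ d := by exact_mod_cast hd
  have hη0 : 0 ≤ η := le_trans (by positivity) hη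
  have hup : avgF c 0 - ∑ r ∈ Finset.range (m+1), α r * avgF c (nodeV r) ≤ weight c * (18 * η^(m+1)) := by
    have e : avgF c 0 - ∑ r ∈ Finset.range (m+1), α r * avgF c (nodeV r)
        = ∑ S : Finset (Fin d), c S * (1 - ∑ r ∈ Finset.range (m+1), α r * (1 - 2 * S.card / d)^(nodeV r)) := by
      unfold avgF
      simp only [mul_sub, Finset.sum_sub_distrib, Finset.mul_sum]
      rw [Finset.sum_comm]
      congr 1
      exact Finset.sum_congr rfl fun _ _ => Finset.sum_congr rfl fun _ _ => by ring
    rw [e]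
    refine (le_abs_self _).trans ((Finset.abs_sum_le_sum_abs _ _).trans ?_)
    unfold weight
    rw [Finset.sum_mul]
    refine Finset.sum_le_sum fun S _ => ?_
    rw [abs_mul]
    by_cases hS : c S = 0
    · simp [hS]
    refine mul_le_mul_of_nonneg_left ?_ (abs_nonneg _)
    refine remainder m k hk hmk α h1 h2 (2 * S.card / d) η (by positivity) (le_trans ?_ hη) hη2
    have : S.card ≤ polyDegree c := by
      unfold polyDegree
      exact Finset.le_sup (f := Finset.card) (by simpa using hS)
    have : (S.card : ℝ) ≤ polyDegree c := by exact_mod_cast this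
    gcongr
  have h0 := avgF_zero c h
  have hs1 : ∑ r ∈ Finset.range (m+1), α r = 1 := by simpa using h1 0 (by omega)
  have hlow : ∑ r ∈ Finset.range (m+1), α r * avgF c (nodeV r) ≤ -1 + 9 * (1/6 + 2/d) := by
    have e : ∑ r ∈ Finset.range (m+1), α r * avgF c (nodeV r)
        = -1 + ∑ r ∈ Finset.range (m+1), α r * (avgF c (nodeV r) + 1) := by
      simp only [mul_add, Finset.sum_add_distrib, mul_one, hs1]; ring
    rw [e]
    have : ∑ r ∈ Finset.range (m+1), α r * (avgF c (nodeV r) + 1) ≤ 9 * (1/6 + 2/d) := by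
      refine le_trans ?_ (mul_le_mul_of_nonneg_right h2 (by positivity))
      rw [Finset.sum_mul]
      refine Finset.sum_le_sum fun r hr => (le_abs_self _).trans ?_
      rw [abs_mul]
      exact mul_le_mul_of_nonneg_left (avgF_pos (by omega) c h _ (nodeV_pos r)
        (nodeV_le r m k (by simpa [Nat.lt_succ_iff] using hr) hk hmk)) (abs_nonneg _)
    linarith
  have : (2:ℝ)/d ≤ 1/54 := by
    rw [div_le_div_iff₀ (by positivity) (by positivity)]; linarith
  linarith

theorem stmt_14 : ∀ a : ℝ, 0 ≤ a → ∃ C > (0 : ℝ), ∀ d k : ℕ, 1 ≤ k →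
    C * k ≤ Real.log d →
    ∀ c : Finset (Fin d) → ℝ, weight c ≤ (d : ℝ) ^ a →
      (∀ x ∈ cube d, hamming x ≤ k → |evalPoly c x - ORd x| ≤ 1 / 6) →
      (d : ℝ) ^ (1 - C / Real.sqrt k) ≤ polyDegree c := by
  intro a ha
  refine ⟨3 * a + 15, by linarith, ?_⟩
  intro d k hk hL c hW h
  set C : ℝ := 3 * a + 15 with hC
  have hC15 : 15 ≤ C := by linarith
  by_contra hcon
  push Not at hcon
  have hk1 : (1:ℝ) ≤ k := by exact_mod_cast hk
  set L := Real.log d with hLdef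
  have hL15 : 15 ≤ L := by nlinarith
  have hdpos : (0:ℝ) < d := by
    rcases Nat.eq_zero_or_pos d with h0 | h0
    · rw [hLdef, h0] at hL15; norm_num at hL15
    · exact_mod_cast h0
  have hdexp : (d:ℝ) = Real.exp L := (Real.exp_log hdpos).symm
  have hd108 : 108 ≤ d := by
    have h1 := Real.quadratic_le_exp_of_nonneg (x := L) (by linarith)
    rw [← hdexp] at h1
    have : (108:ℝ) ≤ d := by nlinarith
    exact_mod_cast this
  have hrpow : ∀ y : ℝ, (d:ℝ)^y = Real.exp (L * y) := fun y => Real.rpow_def_of_pos hdpos y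
  set s := Real.sqrt k with hs
  have hs2 : s^2 = k := Real.sq_sqrt (by linarith)
  have hs1 : 1 ≤ s := by rw [hs]; exact Real.one_le_sqrt.2 hk1
  have hs0 : 0 < s := by linarith
  set y := C * L / (2 * s) with hy
  set ρ := Real.exp (-y) with hρ
  have hy2 : 2 * s ≤ y := by
    rw [hy, le_div_iff₀ (by positivity)]
    have : C * s^2 ≤ L := by rw [hs2]; exact hL
    nlinarith
  have hkρ : 2 * k * ρ ≤ 1 := by
    have h1 := Real.quadratic_le_exp_of_nonneg (x := y) (by linarith)
    have h2 : 2 * (k:ℝ) ≤ Real.exp y := by rw [← hs2]; nlinarith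
    have h3 : Real.exp y * ρ = 1 := by rw [hρ, ← Real.exp_add]; simp
    have : 0 < ρ := Real.exp_pos _
    nlinarith
  have hρ0 : 0 < ρ := Real.exp_pos _
  have hρ2 : ρ ≤ 1/2 := by nlinarith
  have hη : k * (2 * polyDegree c / d) ≤ ρ := by
    have h1 : (polyDegree c : ℝ) ≤ d * ρ^2 := by
      refine hcon.le.trans (le_of_eq ?_)
      rw [hrpow, hdexp, hρ, ← Real.exp_nat_mul, ← Real.exp_add]
      congr 1
      rw [hy]; push_cast; field_simp; ring
    have h2 : (polyDegree c : ℝ) / d ≤ ρ^2 := by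
      rw [div_le_iff₀ hdpos]; linarith
    calc k * (2 * polyDegree c / d) = 2 * k * ((polyDegree c : ℝ) / d) := by ring
      _ ≤ 2 * k * ρ^2 := by gcongr
      _ = (2 * k * ρ) * ρ := by ring
      _ ≤ 1 * ρ := by gcongr
      _ = ρ := one_mul _
  set m := Nat.sqrt (k/2) with hm
  have hm1 : 2 * m^2 ≤ k := by
    have := Nat.sqrt_le' (k/2)
    rw [← hm] at this
    omega
  have hm2 : k < 2 * (m+1)^2 := by
    have := Nat.lt_succ_sqrt' (k/2)
    rw [← hm, Nat.succ_eq_add_one] at this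
    omega
  have hcore := core hd108 hk hm1 c h ρ hη hρ2
  have hsm : s ≤ 3/2 * ((m:ℝ)+1) := by
    have h1 : (k:ℝ) < 2 * ((m:ℝ)+1)^2 := by exact_mod_cast hm2
    rw [← hs2] at h1
    have : (0:ℝ) ≤ m := Nat.cast_nonneg m
    refine (sq_le_sq₀ hs0.le (by positivity)).1 ?_
    nlinarith
  have hpow : ρ^(m+1) ≤ Real.exp (-(C * L / 3)) := by
    rw [hρ, ← Real.exp_nat_mul]
    apply Real.exp_le_exp.2
    have : C * L / 3 ≤ ((m:ℝ)+1) * y := by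
      rw [hy, ← mul_div_assoc, div_le_div_iff₀ (by norm_num) (by positivity)]
      have : 0 ≤ C * L := by positivity
      nlinarith
    push_cast
    linarith
  rw [hrpow] at hW
  have hfin : weight c * (18 * ρ^(m+1)) ≤ 18 * Real.exp (-(5*L)) := by
    calc _ ≤ Real.exp (L*a) * (18 * Real.exp (-(C * L / 3))) := by gcongr
      _ = 18 * (Real.exp (L*a) * Real.exp (-(C*L/3))) := by ring
      _ = _ := by rw [← Real.exp_add]; congr 2; rw [hC]; ring
  have h5 := Real.quadratic_le_exp_of_nonneg (x := 5*L) (by linarith)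
  have h6 : Real.exp (5*L) * Real.exp (-(5*L)) = 1 := by rw [← Real.exp_add]; simp
  have h7 : 0 < Real.exp (-(5*L)) := Real.exp_pos _
  have h8 : 200 ≤ Real.exp (5*L) := by nlinarith
  nlinarith
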